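/- Let Q be a positive definite real symmetric n×n matrix and let P be a real polynomial in n variables. Define the second-order differential operator L on polynomials by (L P) = Σ_{i,j=1}^{n} (Q⁻¹)_{ij} ∂ᵢ∂ⱼ P. Then x ↦ P(x) e^{-½Q(x,x)} is integrable on ℝⁿ, and (∫_{ℝⁿ} P(x) e^{-½Q(x,x)} dx) / (∫_{ℝⁿ} e^{-½Q(x,x)} dx) = Σ_{m=0}^{M} (1/(2^m m!)) · (L^m P)(0) for any M with 2M ≥ deg P (the sum is independent of such M, since L^m P = 0 once 2m exceeds the total degree of P). Equivalently, the normalized Gaussian expectation of P equals the evaluation at x = 0 of e^{½ Q⁻¹(∂,∂)} P. -/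

import Mathlib

open MeasureTheory

noncomputable section

/-- The quadratic form `Q(x,x) = Σ_{i,j} Q_{ij} x_i x_j` of a real `n×n` matrix. -/
def quadForm (n : ℕ) (Q : Matrix (Fin n) (Fin n) ℝ) (x : Fin n → ℝ) : ℝ :=
  ∑ i : Fin n, ∑ j : Fin n, Q i j * x i * x j

/-- The second-order differential operator `L = Q⁻¹(∂,∂) = Σ_{i,j} (Q⁻¹)_{ij} ∂ᵢ∂ⱼ` acting
on polynomials in `n` variables. -/
def wickOperator (n : ℕ) (Q : Matrix (Fin n) (Fin n) ℝ)
    (P : MvPolynomial (Fin n) ℝ) : MvPolynomial (Fin n) ℝ :=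
  ∑ i : Fin n, ∑ j : Fin n, Q⁻¹ i j • MvPolynomial.pderiv i (MvPolynomial.pderiv j P)

namespace MvPolynomial

variable {ι : Type*}

theorem pderiv_commute (i j : ι) :
    Commute (S := Module.End ℝ (MvPolynomial ι ℝ))
      (pderiv i).toLinearMap (pderiv j).toLinearMap := by
  classical
  have h : ⁅pderiv (R := ℝ) i, pderiv (R := ℝ) j⁆ = 0 := by
    refine derivation_ext fun k => ?_
    simp only [Derivation.commutator_apply, pderiv_X, Pi.single_apply, Derivation.zero_apply]
    split_ifs <;> simp
  refine LinearMap.ext fun p => ?_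
  have := congrArg (fun D => D p) h
  simpa [Derivation.commutator_apply, sub_eq_zero] using this

theorem hasLineDerivAt_eval [Fintype ι] [DecidableEq ι] (p : MvPolynomial ι ℝ) (x : ι → ℝ)
    (i : ι) :
    HasLineDerivAt ℝ (fun y => eval y p) (eval x (pderiv i p)) x (Pi.single i 1) := by
  unfold HasLineDerivAt
  induction p using MvPolynomial.induction_on with
  | C a => simpa using hasDerivAt_const (0 : ℝ) a
  | add p q hp hq =>
    simp only [map_add]
    exact hp.add hq
  | mul_X p j hp =>
    have hX : HasDerivAt (fun t : ℝ => (x + t • (Pi.single i 1 : ι → ℝ)) j)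
        ((Pi.single i (1 : ℝ) : ι → ℝ) j) 0 := by
      simpa using
        ((hasDerivAt_id (0 : ℝ)).mul_const ((Pi.single i (1 : ℝ) : ι → ℝ) j)).const_add (x j)
    have := hp.mul hX
    simp only [map_mul, eval_X, pderiv_mul, map_add, pderiv_X]
    refine this.congr_deriv ?_
    by_cases h : i = j
    · subst h; simp
    · simp [Ne.symm h]

variable [Fintype ι]

/-- The directional derivative `∑ⱼ Aᵢⱼ ∂ⱼ` along the `i`-th row of `A`. -/
def rowDeriv (A : Matrix ι ι ℝ) (i : ι) : Module.End ℝ (MvPolynomial ι ℝ) :=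
  ∑ j, A i j • (pderiv j).toLinearMap

/-- The second-order operator `∑ᵢⱼ Aᵢⱼ ∂ᵢ∂ⱼ`. -/
def secondOrder (A : Matrix ι ι ℝ) : Module.End ℝ (MvPolynomial ι ℝ) :=
  ∑ i, ∑ j, A i j • ((pderiv i).toLinearMap ∘ₗ (pderiv j).toLinearMap)

theorem rowDeriv_apply (A : Matrix ι ι ℝ) (i : ι) (p : MvPolynomial ι ℝ) :
    rowDeriv A i p = ∑ j, A i j • pderiv j p := by
  simp [rowDeriv]

theorem secondOrder_apply (A : Matrix ι ι ℝ) (p : MvPolynomial ι ℝ) :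
    secondOrder A p = ∑ i, ∑ j, A i j • pderiv i (pderiv j p) := by
  simp [secondOrder]

theorem secondOrder_commute_rowDeriv (A : Matrix ι ι ℝ) (i : ι) :
    Commute (secondOrder A) (rowDeriv A i) :=
  Commute.sum_left _ _ _ fun k _ => Commute.sum_left _ _ _ fun l _ =>
    Commute.sum_right _ _ _ fun j _ =>
      (((pderiv_commute k j).mul_left (pderiv_commute l j)).smul_left _).smul_right _

theorem secondOrder_X_mul {A : Matrix ι ι ℝ} (hA : A.IsSymm) (i : ι) (p : MvPolynomial ι ℝ) :
    secondOrder A (X i * p) = X i * secondOrder A p + (2 : ℝ) • rowDeriv A i p := by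
  classical
  have h (k l : ι) : A k l • pderiv k (pderiv l (X i * p)) =
      X i * (A k l • pderiv k (pderiv l p)) + (if i = l then A k l • pderiv k p else 0)
        + (if i = k then A k l • pderiv l p else 0) := by
    simp only [pderiv_mul, pderiv_X, map_add, Pi.single_apply]
    split_ifs <;> simp [smul_add] <;> abel
  simp only [secondOrder_apply, rowDeriv_apply, h, Finset.sum_add_distrib, Finset.mul_sum,
    Finset.sum_ite_eq, Finset.mem_univ, if_true]
  rw [Finset.sum_comm (f := fun k l => if i = k then A k l • pderiv l p else 0)]
  simp only [Finset.sum_ite_eq, Finset.mem_univ, if_true, hA.apply, add_assoc, two_smul]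

theorem secondOrder_pow_X_mul {A : Matrix ι ι ℝ} (hA : A.IsSymm) (i : ι) (m : ℕ)
    (p : MvPolynomial ι ℝ) :
    (secondOrder A ^ (m + 1)) (X i * p) = X i * (secondOrder A ^ (m + 1)) p +
      (2 * (m + 1) : ℝ) • (secondOrder A ^ m) (rowDeriv A i p) := by
  induction m generalizing p with
  | zero => simp [secondOrder_X_mul hA]
  | succ m ih =>
    have hc : rowDeriv A i (secondOrder A p) = secondOrder A (rowDeriv A i p) :=
      (LinearMap.congr_fun (secondOrder_commute_rowDeriv A i) p).symm
    rw [pow_succ (secondOrder A) (m + 1), Module.End.mul_apply, Module.End.mul_apply,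
      secondOrder_X_mul hA, map_add, ih, hc, map_smul, ← Module.End.mul_apply (secondOrder A ^ m),
      ← pow_succ, add_assoc, ← add_smul]
    push_cast
    ring_nf

/-- The functional `p ↦ ∑_{m ≤ M} (Lᵐ p)(0) / (2ᵐ m!)`, where `L = ∑ᵢⱼ Aᵢⱼ ∂ᵢ∂ⱼ`. -/
def wickSum (A : Matrix ι ι ℝ) (M : ℕ) : MvPolynomial ι ℝ →ₗ[ℝ] ℝ :=
  ∑ m ∈ Finset.range (M + 1), (1 / (2 ^ m * m.factorial : ℝ)) •
    ((aeval (0 : ι → ℝ)).toLinearMap ∘ₗ (secondOrder A ^ m))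

theorem wickSum_apply (A : Matrix ι ι ℝ) (M : ℕ) (p : MvPolynomial ι ℝ) :
    wickSum A M p = ∑ m ∈ Finset.range (M + 1),
      (1 / (2 ^ m * m.factorial : ℝ)) * eval 0 ((secondOrder A ^ m) p) := by
  simp [wickSum, aeval_eq_eval]

theorem wickSum_C (A : Matrix ι ι ℝ) (M : ℕ) (a : ℝ) : wickSum A M (C a) = a := by
  have h : secondOrder A (C a) = 0 := by simp [secondOrder_apply]
  simp [wickSum_apply, Finset.sum_range_succ', pow_succ, h]

theorem wickSum_X_mul {A : Matrix ι ι ℝ} (hA : A.IsSymm) (M : ℕ) (i : ι)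
    (p : MvPolynomial ι ℝ) :
    wickSum A (M + 1) (X i * p) = wickSum A M (rowDeriv A i p) := by
  rw [wickSum_apply, wickSum_apply, Finset.sum_range_succ']
  simp only [secondOrder_pow_X_mul hA, map_add, map_mul, eval_X, Pi.zero_apply, zero_mul,
    zero_add, smul_eval, pow_zero, Module.End.one_apply, mul_zero, add_zero]
  refine Finset.sum_congr rfl fun m _ => ?_
  rw [Nat.factorial_succ]
  push_cast
  field_simp
  ring

/-- A functional satisfying Wick's recursion is determined by its value at `1`. -/
theorem eq_mul_wickSum_of_wick_recursion {A : Matrix ι ι ℝ} (hA : A.IsSymm)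
    (E : MvPolynomial ι ℝ →ₗ[ℝ] ℝ) (hE : ∀ i p, E (X i * p) = E (rowDeriv A i p))
    (M : ℕ) (p : MvPolynomial ι ℝ) (hp : p.totalDegree ≤ 2 * M) :
    E p = E 1 * wickSum A M p := by
  classical
  have hC (M : ℕ) (a : ℝ) : E (C a) = E 1 * wickSum A M (C a) := by
    rw [wickSum_C, ← mul_one (C a), ← smul_eq_C_mul, map_smul, smul_eq_mul, mul_comm]
  have key : ∀ (M : ℕ) (s : ι →₀ ℕ) (a : ℝ), s.degree ≤ 2 * M →
      E (monomial s a) = E 1 * wickSum A M (monomial s a) := by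
    intro M
    induction M with
    | zero =>
      intro s a hs
      obtain rfl : s = 0 := (Finsupp.degree_eq_zero_iff s).1 (by omega)
      exact hC 0 a
    | succ M ih =>
      intro s a hs
      rcases eq_or_ne s 0 with rfl | hs0
      · exact hC _ a
      obtain ⟨i, hi⟩ := Finsupp.ne_iff.1 hs0
      obtain ⟨t, rfl⟩ : ∃ t, s = Finsupp.single i 1 + t :=
        exists_add_of_le (Finsupp.single_le_iff.2 (Nat.one_le_iff_ne_zero.2 hi))
      have hX : monomial (Finsupp.single i 1 + t) a = X i * monomial t a := by
        rw [X, monomial_mul, one_mul]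
      rw [hX, hE, wickSum_X_mul hA, rowDeriv_apply, map_sum, map_sum, Finset.mul_sum]
      refine Finset.sum_congr rfl fun j _ => ?_
      rw [map_smul, map_smul, pderiv_monomial, smul_eq_mul, smul_eq_mul, mul_left_comm]
      congr 1
      rcases Nat.eq_zero_or_pos (t j) with htj | htj
      · simp [htj]
      · obtain ⟨u, rfl⟩ : ∃ u, t = Finsupp.single j 1 + u :=
          exists_add_of_le (Finsupp.single_le_iff.2 htj)
        apply ih
        simp only [map_add, Finsupp.degree_single] at hs
        rw [add_tsub_cancel_left]
        omega
  rw [p.as_sum, map_sum, map_sum, Finset.mul_sum]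
  exact Finset.sum_congr rfl fun s hs => key M s _ ((le_totalDegree hs).trans hp)

end MvPolynomial

open MvPolynomial

section Gaussian

variable {n : ℕ} {Q : Matrix (Fin n) (Fin n) ℝ}

theorem wickOperator_eq_secondOrder : wickOperator n Q = secondOrder Q⁻¹ :=
  funext fun p => (secondOrder_apply _ p).symm

theorem continuous_quadForm : Continuous (quadForm n Q) := by
  unfold quadForm
  fun_prop

theorem quadForm_smul (c : ℝ) (x : Fin n → ℝ) :
    quadForm n Q (c • x) = c ^ 2 * quadForm n Q x := by
  simp only [quadForm, Pi.smul_apply, smul_eq_mul, Finset.mul_sum]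
  exact Finset.sum_congr rfl fun i _ => Finset.sum_congr rfl fun j _ => by ring

theorem exists_mul_sum_sq_le_quadForm (hQ : ∀ x : Fin n → ℝ, x ≠ 0 → 0 < quadForm n Q x) :
    ∃ c > 0, ∀ x, c * ∑ i, x i ^ 2 ≤ quadForm n Q x := by
  obtain ⟨a, ha, hle⟩ := (isCompact_sphere (0 : Fin n → ℝ) 1).exists_forall_le'
    continuous_quadForm.continuousOn (a := 0) fun x hx => hQ x (ne_zero_of_mem_unit_sphere ⟨x, hx⟩)
  refine ⟨a / (n + 1), by positivity, fun x => ?_⟩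
  have hsum : ∑ i, x i ^ 2 ≤ (n + 1) * ‖x‖ ^ 2 := by
    calc ∑ i, x i ^ 2 ≤ ∑ _i : Fin n, ‖x‖ ^ 2 := Finset.sum_le_sum fun i _ => by
          rw [← sq_abs, ← Real.norm_eq_abs]
          gcongr
          exact norm_le_pi_norm x i
      _ ≤ (n + 1) * ‖x‖ ^ 2 := by
           simp only [Finset.sum_const, Finset.card_univ, Fintype.card_fin, nsmul_eq_mul]
           nlinarith [sq_nonneg ‖x‖]
  have hnorm : a * ‖x‖ ^ 2 ≤ quadForm n Q x := by
    rcases eq_or_ne x 0 with rfl | hx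
    · simp [quadForm]
    have hx' : ‖x‖ ≠ 0 := norm_ne_zero_iff.2 hx
    have h := hle (‖x‖⁻¹ • x) (by simp [norm_smul, hx'])
    rw [quadForm_smul, inv_pow, inv_mul_eq_div, le_div_iff₀ (by positivity)] at h
    exact h
  calc a / (n + 1) * ∑ i, x i ^ 2 ≤ a / (n + 1) * ((n + 1) * ‖x‖ ^ 2) := by gcongr
    _ = a * ‖x‖ ^ 2 := by field_simp
    _ ≤ _ := hnorm

theorem integrable_pow_mul_exp_neg_mul_sq {b : ℝ} (hb : 0 < b) (k : ℕ) :
    Integrable fun x : ℝ => x ^ k * Real.exp (-b * x ^ 2) := by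
  simpa using integrable_rpow_mul_exp_neg_mul_sq hb (s := k) (by linarith [k.cast_nonneg (α := ℝ)])

theorem integrable_eval_mul_exp_neg_quadForm
    (hQ : ∀ x : Fin n → ℝ, x ≠ 0 → 0 < quadForm n Q x) (P : MvPolynomial (Fin n) ℝ) :
    Integrable fun x => eval x P * Real.exp (-(1 / 2) * quadForm n Q x) := by
  obtain ⟨c, hc, hle⟩ := exists_mul_sum_sq_le_quadForm hQ
  induction P using MvPolynomial.induction_on' with
  | add p q hp hq =>
    simp only [map_add, add_mul]
    exact hp.add hq
  | monomial s a =>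
    have hprod : Integrable fun x : Fin n → ℝ =>
        ∏ i, (x i ^ s i * Real.exp (-(c / 2) * x i ^ 2)) :=
      Integrable.fintype_prod fun i => integrable_pow_mul_exp_neg_mul_sq (half_pos hc) (s i)
    refine (hprod.const_mul a).mono ?_ (.of_forall fun x => ?_)
    · exact ((continuous_eval _).mul
        (continuous_const.mul continuous_quadForm).rexp).aestronglyMeasurable
    · rw [eval_monomial, Finsupp.prod_fintype _ _ (by simp), Finset.prod_mul_distrib,
        ← Real.exp_sum, ← mul_assoc, norm_mul, norm_mul _ (Real.exp _)]
      gcongr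
      rw [Real.norm_eq_abs, Real.norm_eq_abs, Real.abs_exp, Real.abs_exp, Real.exp_le_exp,
        ← Finset.mul_sum]
      linarith [hle x]

/-- The unnormalized Gaussian integral as a linear functional on polynomials. -/
def gaussianFunctional (hQ : ∀ x : Fin n → ℝ, x ≠ 0 → 0 < quadForm n Q x) :
    MvPolynomial (Fin n) ℝ →ₗ[ℝ] ℝ where
  toFun P := ∫ x, eval x P * Real.exp (-(1 / 2) * quadForm n Q x)
  map_add' p q := by
    simp only [map_add, add_mul]
    exact integral_add (integrable_eval_mul_exp_neg_quadForm hQ p)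
      (integrable_eval_mul_exp_neg_quadForm hQ q)
  map_smul' a p := by
    simp only [smul_eval, mul_assoc, integral_const_mul, RingHom.id_apply, smul_eq_mul]

theorem hasLineDerivAt_exp_neg_quadForm (hQ : Q.IsSymm) (x : Fin n → ℝ) (i : Fin n) :
    HasLineDerivAt ℝ (fun y => Real.exp (-(1 / 2) * quadForm n Q y))
      (-(eval x (∑ j, Q i j • X j) * Real.exp (-(1 / 2) * quadForm n Q x))) x (Pi.single i 1) := by
  let q : MvPolynomial (Fin n) ℝ := ∑ k, ∑ l, Q k l • (X k * X l)
  have hq (y : Fin n → ℝ) : quadForm n Q y = eval y q := by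
    simp only [quadForm, q, map_sum, smul_eval, map_mul, eval_X, mul_assoc]
  have hd : pderiv i q = (2 : ℝ) • ∑ j, Q i j • X j := by
    have hkl (k l : Fin n) : pderiv i (Q k l • (X k * X l)) =
        (if i = k then Q k l • (X l : MvPolynomial (Fin n) ℝ) else 0) +
          (if i = l then Q k l • X k else 0) := by
      rw [Derivation.map_smul, pderiv_mul, pderiv_X, pderiv_X, Pi.single_apply, Pi.single_apply]
      simp only [eq_comm (a := i)]
      split_ifs <;> simp
    simp only [q, map_sum, hkl, Finset.sum_add_distrib]
    rw [Finset.sum_comm (f := fun k l => if i = k then Q k l • (X l : MvPolynomial (Fin n) ℝ) else 0)]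
    simp only [Finset.sum_ite_eq, Finset.mem_univ, if_true, hQ.apply, two_smul]
  have h := hasLineDerivAt_eval q x i
  simp only [hq]
  refine (HasDerivAt.exp (HasDerivAt.const_mul (-(1 / 2)) h)).congr_deriv ?_
  simp only [hd, smul_eval, zero_smul, add_zero]
  ring

theorem gaussianFunctional_mul_linear (hsymm : Q.IsSymm)
    (hQ : ∀ x : Fin n → ℝ, x ≠ 0 → 0 < quadForm n Q x) (i : Fin n)
    (P : MvPolynomial (Fin n) ℝ) :
    gaussianFunctional hQ (P * ∑ j, Q i j • X j) = gaussianFunctional hQ (pderiv i P) := by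
  have hint := integrable_eval_mul_exp_neg_quadForm hQ
  have hlin : Integrable fun x => eval x P *
      -(eval x (∑ j, Q i j • X j) * Real.exp (-(1 / 2) * quadForm n Q x)) := by
    simp only [mul_neg, ← mul_assoc, ← map_mul]
    exact (hint (P * ∑ j, Q i j • X j)).neg
  have h := integral_bilinear_hasLineDerivAt_right_eq_neg_left_of_integrable (μ := volume)
    (B := ContinuousLinearMap.mul ℝ ℝ) (v := Pi.single i 1)
    (f := fun x => eval x P) (f' := fun x => eval x (pderiv i P))
    (g := fun x => Real.exp (-(1 / 2) * quadForm n Q x))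
    (g' := fun x => -(eval x (∑ j, Q i j • X j) * Real.exp (-(1 / 2) * quadForm n Q x)))
    (hint (pderiv i P)) hlin (hint P)
    (fun x _ => hasLineDerivAt_eval P x i)
    (fun x _ => hasLineDerivAt_exp_neg_quadForm hsymm x i)
  simp only [ContinuousLinearMap.mul_apply', mul_neg, integral_neg, neg_inj] at h
  simpa only [gaussianFunctional, LinearMap.coe_mk, AddHom.coe_mk, map_mul, mul_assoc] using h

theorem isUnit_det_of_quadForm_pos (hQ : ∀ x : Fin n → ℝ, x ≠ 0 → 0 < quadForm n Q x) :
    IsUnit Q.det := by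
  rw [isUnit_iff_ne_zero]
  intro h
  obtain ⟨v, hv, hv0⟩ := Matrix.exists_mulVec_eq_zero_iff.2 h
  refine (hQ v hv).ne' ?_
  have : quadForm n Q v = v ⬝ᵥ Q.mulVec v := by
    simp only [quadForm, dotProduct, Matrix.mulVec, Finset.mul_sum]
    exact Finset.sum_congr rfl fun i _ => Finset.sum_congr rfl fun j _ => by ring
  rw [this, hv0, dotProduct_zero]

theorem gaussianFunctional_X_mul (hsymm : Q.IsSymm)
    (hQ : ∀ x : Fin n → ℝ, x ≠ 0 → 0 < quadForm n Q x) (i : Fin n)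
    (P : MvPolynomial (Fin n) ℝ) :
    gaussianFunctional hQ (X i * P) = gaussianFunctional hQ (rowDeriv Q⁻¹ i P) := by
  have hX : (X i : MvPolynomial (Fin n) ℝ) = ∑ k, Q⁻¹ i k • ∑ j, Q k j • X j := by
    simp only [Finset.smul_sum, smul_smul]
    rw [Finset.sum_comm]
    simp only [← Finset.sum_smul, ← Matrix.mul_apply,
      Matrix.nonsing_inv_mul Q (isUnit_det_of_quadForm_pos hQ), Matrix.one_apply]
    simp
  rw [hX, rowDeriv_apply, mul_comm, Finset.mul_sum, map_sum, map_sum]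
  refine Finset.sum_congr rfl fun k _ => ?_
  rw [mul_smul_comm, map_smul, map_smul, gaussianFunctional_mul_linear hsymm]

end Gaussian

/-- **Wick's lemma via the exponential of a second-order differential operator.** For a
positive definite symmetric `Q` and a polynomial `P`, the function `P(x)e^{-½Q(x,x)}` is
integrable and the normalized Gaussian expectation of `P` equals
`Σ_{m=0}^{M} (1/(2^m m!)) (L^m P)(0)` for any `M` with `2M ≥ deg P`; that is, it equals
the evaluation at `x = 0` of `e^{½ Q⁻¹(∂,∂)} P`. -/
theorem gaussian_expectation_via_operator
    (n : ℕ) (Q : Matrix (Fin n) (Fin n) ℝ) (hQsymm : Q.IsSymm)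
    (hQpos : ∀ x : Fin n → ℝ, x ≠ 0 → 0 < quadForm n Q x)
    (P : MvPolynomial (Fin n) ℝ) :
    Integrable (fun x : Fin n → ℝ =>
        MvPolynomial.eval x P * Real.exp (-(1 / 2) * quadForm n Q x)) ∧
    ∀ M : ℕ, P.totalDegree ≤ 2 * M →
      (∫ x : Fin n → ℝ, MvPolynomial.eval x P * Real.exp (-(1 / 2) * quadForm n Q x)) /
          (∫ x : Fin n → ℝ, Real.exp (-(1 / 2) * quadForm n Q x))
        = ∑ m ∈ Finset.range (M + 1),
            (1 / (2 ^ m * (Nat.factorial m) : ℝ)) *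
              MvPolynomial.eval (0 : Fin n → ℝ) ((wickOperator n Q)^[m] P) := by
  refine ⟨integrable_eval_mul_exp_neg_quadForm hQpos P, fun M hM => ?_⟩
  have hA : Q⁻¹.IsSymm := by rw [Matrix.IsSymm, Matrix.transpose_nonsing_inv, hQsymm]
  have h := eq_mul_wickSum_of_wick_recursion hA (gaussianFunctional hQpos)
    (gaussianFunctional_X_mul hQsymm hQpos) M P hM
  have hint : Integrable fun x => Real.exp (-(1 / 2) * quadForm n Q x) := by
    simpa using integrable_eval_mul_exp_neg_quadForm hQpos 1
  have hpos : 0 < ∫ x, Real.exp (-(1 / 2) * quadForm n Q x) := integral_exp_pos hint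
  simp only [gaussianFunctional, LinearMap.coe_mk, AddHom.coe_mk, map_one, one_mul] at h
  rw [h, mul_div_cancel_left₀ _ hpos.ne', wickSum_apply, wickOperator_eq_secondOrder]
  simp only [Module.End.pow_apply]
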